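/- arXiv:1601.01786 — 4 statements merged into one kernel-verified Lean document; each statement's English description precedes it below -/
import Mathlib

section
/- Let H=(V',E') be a finite symmetric directed graph with distinguished nodes S', D' ∈ V', n = |V'|, and let N be the gadget multi-layer network over protocols A={a,b} constructed from H with source S and destination D. Then H contains a directed Hamiltonian path from S' to D' if and only if N contains a feasible path from S to D (with source protocol a) that traverses each arc of N at most once (i.e., satisfies the bandwidth constraint q_b^min = 1 when every arc has bandwidth 1). -/
/-- An adaptation function: conversion `(a→b)` (passive when `a = b`),
encapsulation `(a→ab)`, or decapsulation `dec(a→ab)`. -/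
inductive AdaptFn (A : Type*) where
  | conv : A → A → AdaptFn A
  | encap : A → A → AdaptFn A
  | decap : A → A → AdaptFn A
  deriving DecidableEq

/-- How an adaptation function transforms a configuration
(current protocol, stack of encapsulated protocols):
`(a→b)` maps `(a,σ)` to `(b,σ)`; `(a→ab)` maps `(a,σ)` to `(b,aσ)`;
`dec(a→ab)` maps `(b,aσ)` to `(a,σ)`; otherwise it is inapplicable. -/
inductive AdaptStep {A : Type*} : AdaptFn A → A × List A → A × List A → Prop
  | conv (x y : A) (σ : List A) : AdaptStep (.conv x y) (x, σ) (y, σ)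
  | encap (x y : A) (σ : List A) : AdaptStep (.encap x y) (x, σ) (y, x :: σ)
  | decap (x y : A) (σ : List A) : AdaptStep (.decap x y) (y, x :: σ) (x, σ)

/-- A multi-layer network: a directed graph `Edge` on nodes `V` together with,
for each node, the set `F` of adaptation functions available there. -/
structure MLNetwork (V A : Type*) where
  Edge : V → V → Prop
  F : V → Set (AdaptFn A)

/-- `Run N c steps c'`: starting in configuration `c`, the adaptation functions of
`steps` are successively applicable (each being available at the node where it is
applied) and lead to configuration `c'`. -/
inductive Run {V A : Type*} (N : MLNetwork V A) :
    A × List A → List (V × AdaptFn A) → A × List A → Prop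
  | nil (c : A × List A) : Run N c [] c
  | cons {U : V} {f : AdaptFn A} {c c' c'' : A × List A} {rest : List (V × AdaptFn A)} :
      f ∈ N.F U → AdaptStep f c c' → Run N c' rest c'' → Run N c ((U, f) :: rest) c''

/-- Node sequence of the path `S U₁ f₁ U₂ f₂ ... Uₙ fₙ D`. -/
def nodeSeq {V A : Type*} (S D : V) (steps : List (V × AdaptFn A)) : List V :=
  S :: steps.map Prod.fst ++ [D]

/-- `S U₁ f₁ ... Uₙ fₙ D` (with `steps = [(U₁,f₁),...,(Uₙ,fₙ)]`) is a feasible path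
from `S` to `D` with source protocol `s`: consecutive nodes are linked by arcs,
each `fᵢ ∈ F(Uᵢ)`, the functions are successively applicable starting from
configuration `(s, empty stack)`, and the final stack at `D` is empty. -/
def IsFeasiblePath {V A : Type*} (N : MLNetwork V A) (S D : V) (s : A)
    (steps : List (V × AdaptFn A)) : Prop :=
  (nodeSeq S D steps).Chain' N.Edge ∧ ∃ x : A, Run N (s, []) steps (x, [])

/-- A walk given by its vertex list traverses each arc at most once. -/
def ArcsOnce {V : Type*} (l : List V) : Prop := (l.zip l.tail).Nodup

/-- The two protocols `a` and `b` of the gadget network. -/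
inductive Proto where
  | a | b
  deriving DecidableEq

/-- Nodes of the gadget network: `gadget U' i` is `U_{i+1}` for `i : Fin 4`
(so `gadget U' 0 = U₁`, ..., `gadget U' 3 = U₄`), `tail i` is `C_i`
(with `C_0 = S` the source; indices `> n+1` are isolated unused nodes),
`X` is the auxiliary node and `dst` is the destination `D`. -/
inductive GNode (V' : Type*) where
  | gadget : V' → Fin 4 → GNode V'
  | tail : ℕ → GNode V'
  | X : GNode V'
  | dst : GNode V'
  deriving DecidableEq

/-- Arcs of the gadget network built from the digraph `(V', E')` with `n = |V'|`:
`(U_i,U_{i+1})` and `(U_{i+1},U_i)` for `i=1,2,3`; `(U₁,V₁)` for each arc `(U',V') ∈ E'`;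
`(C_i,C_{i+1})` and `(C_{i+1},C_i)` for `i = 0,...,n`; `(C_{n+1},S₁)` and `(S₁,C_{n+1})`;
`(D₁,X),(X,D₁),(X,D),(D,X)`. -/
def GEdge {V' : Type*} (E' : V' → V' → Prop) (n : ℕ) (S' D' : V') :
    GNode V' → GNode V' → Prop
  | .gadget U i, .gadget W j =>
      (U = W ∧ (i.val + 1 = j.val ∨ j.val + 1 = i.val)) ∨ (i = 0 ∧ j = 0 ∧ E' U W)
  | .tail i, .tail j => (i + 1 = j ∨ j + 1 = i) ∧ i ≤ n + 1 ∧ j ≤ n + 1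
  | .tail i, .gadget U j => i = n + 1 ∧ U = S' ∧ j = 0
  | .gadget U j, .tail i => i = n + 1 ∧ U = S' ∧ j = 0
  | .gadget U j, .X => U = D' ∧ j = 0
  | .X, .gadget U j => U = D' ∧ j = 0
  | .X, .dst => True
  | .dst, .X => True
  | _, _ => False

/-- Adaptation functions of the gadget network: `F(C_i) = {(a→aa)}` for `1 ≤ i ≤ n`,
`F(C_{n+1}) = {(a→ab)}`, `F(U₁) = {(b→bb),(a→ab)}`, `F(U₂) = {dec(b→bb),(a→a)}`,
`F(U₃) = {dec(a→ab),(a→a)}`, `F(U₄) = {dec(a→aa)}`, `F(X) = {dec(a→ab)}`,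
and no function elsewhere. -/
def GF {V' : Type*} (n : ℕ) : GNode V' → Set (AdaptFn Proto)
  | .gadget _ i =>
      if i.val = 0 then {.encap .b .b, .encap .a .b}
      else if i.val = 1 then {.decap .b .b, .conv .a .a}
      else if i.val = 2 then {.decap .a .b, .conv .a .a}
      else {.decap .a .a}
  | .tail i =>
      if 1 ≤ i ∧ i ≤ n then {.encap .a .a}
      else if i = n + 1 then {.encap .a .b} else ∅
  | .X => {.decap .a .b}
  | .dst => ∅

/-- The gadget multi-layer network built from `(V', E')` with `n = |V'|`,
source `S = tail 0` and destination `D = dst`. -/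
def gadgetNet {V' : Type*} (E' : V' → V' → Prop) (n : ℕ) (S' D' : V') :
    MLNetwork (GNode V') Proto :=
  ⟨GEdge E' n S' D', GF n⟩

/-- The node/function sequence
`U₁ (b→bb) U₂ dec(b→bb) U₃ dec(a→ab) U₄ dec(a→aa) U₃ (a→a) U₂ (a→a) U₁ (a→ab)`. -/
def gadgetSeq {V' : Type*} (U : V') : List (GNode V' × AdaptFn Proto) :=
  [(.gadget U 0, .encap .b .b), (.gadget U 1, .decap .b .b), (.gadget U 2, .decap .a .b),
   (.gadget U 3, .decap .a .a), (.gadget U 2, .conv .a .a), (.gadget U 1, .conv .a .a),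
   (.gadget U 0, .encap .a .b)]

/-- The steps traversing the tail straight through:
`C₁ (a→aa) C₂ (a→aa) ... Cₙ (a→aa) C_{n+1} (a→ab)`. -/
def tailSteps {V' : Type*} (n : ℕ) : List (GNode V' × AdaptFn Proto) :=
  ((List.range n).map fun i => (GNode.tail (i + 1), AdaptFn.encap Proto.a Proto.a)) ++
    [(GNode.tail (n + 1), AdaptFn.encap Proto.a Proto.b)]

/-- The full step list of the path from `S` to `D` built from a node order `l`:
the tail, then one `gadgetSeq` per node of `l`, then `X dec(a→ab)`. -/
def hamSteps {V' : Type*} (n : ℕ) (l : List V') : List (GNode V' × AdaptFn Proto) :=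
  tailSteps n ++ l.flatMap gadgetSeq ++ [(.X, .decap .a .b)]

/-- `l` is the vertex sequence of a directed Hamiltonian path from `S'` to `D'`
in the digraph `(V', E')`. -/
def IsDirHamPath {V' : Type*} (E' : V' → V' → Prop) (S' D' : V') (l : List V') : Prop :=
  l.head? = some S' ∧ l.getLast? = some D' ∧ l.Chain' E' ∧ l.Nodup ∧ ∀ v : V', v ∈ l

/-- From node `u` in configuration `c`, the network admits a continuation ending at `D` with
empty stack which never repeats an arc and avoids the arcs in `used`. -/
inductive Completable {V A : Type*} (N : MLNetwork V A) (D : V) :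
    Set (V × V) → V → A × List A → Prop
  | finish {used : Set (V × V)} {u : V} (x : A) :
      N.Edge u D → (u, D) ∉ used → Completable N D used u (x, [])
  | step {used : Set (V × V)} {u v : V} {f : AdaptFn A} {c c' : A × List A} :
      N.Edge u v → (u, v) ∉ used → f ∈ N.F v → AdaptStep f c c' →
      Completable N D (insert (u, v) used) v c' → Completable N D used u c

namespace Completable

theorem anti {V A : Type*} {N : MLNetwork V A} {D : V} {used used' : Set (V × V)} {u : V}
    {c : A × List A} (h : Completable N D used u c) (hsub : used' ⊆ used) :
    Completable N D used' u c := by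
  induction h generalizing used' with
  | finish x he hu => exact .finish x he fun h => hu (hsub h)
  | step he hu hf hs _ ih =>
    exact .step he (fun h => hu (hsub h)) hf hs (ih (Set.insert_subset_insert hsub))

theorem of_steps {V A : Type*} {N : MLNetwork V A} {D : V} {x : A}
    (steps : List (V × AdaptFn A)) (used : Set (V × V)) (u : V) (c : A × List A)
    (hchain : (nodeSeq u D steps).IsChain N.Edge) (hrun : Run N c steps (x, []))
    (honce : ArcsOnce (nodeSeq u D steps))
    (hused : ∀ e ∈ (nodeSeq u D steps).zip (nodeSeq u D steps).tail, e ∉ used) :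
    Completable N D used u c := by
  induction steps generalizing used u c with
  | nil =>
    cases hrun
    simp [nodeSeq] at hchain hused
    exact .finish x hchain hused
  | cons p rest ih =>
    obtain ⟨v, f⟩ := p
    cases hrun with
    | cons hf hs hr =>
      simp only [nodeSeq, ArcsOnce, List.map_cons, List.cons_append, List.isChain_cons_cons,
        List.tail_cons, List.zip_cons_cons, List.nodup_cons, List.forall_mem_cons]
        at hchain honce hused ih
      refine .step hchain.1 hused.1 hf hs (ih _ _ _ hchain.2 hr honce.2 ?_)
      rintro e he (rfl | hmem)
      · exact honce.1 he
      · exact hused.2 e he hmem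

theorem exists_steps {V A : Type*} {N : MLNetwork V A} {D : V} {used : Set (V × V)} {u : V}
    {c : A × List A} (h : Completable N D used u c) :
    ∃ steps : List (V × AdaptFn A), (nodeSeq u D steps).IsChain N.Edge ∧
      (∃ x, Run N c steps (x, [])) ∧ ArcsOnce (nodeSeq u D steps) ∧
      ∀ e ∈ (nodeSeq u D steps).zip (nodeSeq u D steps).tail, e ∉ used := by
  induction h with
  | finish x he hu => exact ⟨[], by simpa [nodeSeq], ⟨x, .nil _⟩, by simp [ArcsOnce, nodeSeq],
      by simpa [nodeSeq]⟩
  | @step used u v f c c' he hu hf hs _ ih =>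
    obtain ⟨steps, hchain, ⟨x, hrun⟩, honce, hused⟩ := ih
    refine ⟨(v, f) :: steps, ?_, ⟨x, .cons hf hs hrun⟩, ?_, ?_⟩ <;>
    simp only [nodeSeq, ArcsOnce, List.map_cons, List.cons_append, List.isChain_cons_cons,
        List.tail_cons, List.zip_cons_cons, List.nodup_cons, List.forall_mem_cons]
        at hchain honce hused ⊢
    · exact ⟨he, hchain⟩
    · exact ⟨fun h => hused _ h (Set.mem_insert _ _), honce⟩
    · exact ⟨hu, fun e he h => hused e he (Set.mem_insert_of_mem _ h)⟩

end Completable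

theorem exists_feasible_arc_once_iff_completable {V A : Type*} (N : MLNetwork V A) (S D : V)
    (s : A) :
    (∃ steps, IsFeasiblePath N S D s steps ∧ ArcsOnce (nodeSeq S D steps)) ↔
      Completable N D ∅ S (s, []) := by
  constructor
  · rintro ⟨steps, ⟨hchain, x, hrun⟩, honce⟩
    exact .of_steps steps ∅ S _ hchain hrun honce fun _ _ h => h
  · intro h
    obtain ⟨steps, hchain, hrun, honce, -⟩ := h.exists_steps
    exact ⟨steps, ⟨hchain, hrun⟩, honce⟩

namespace GadgetNet

variable {V' : Type*} {E' : V' → V' → Prop} {S' D' : V'} {n : ℕ}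

/-! ### Forced moves -/

theorem not_completable_of_exit_used {used : Set (GNode V' × GNode V')} {u : GNode V'}
    {c : Proto × List Proto} (hexit : (.gadget D' 0, .X) ∈ used) (hX : u ≠ .X)
    (hdst : u ≠ .dst) : ¬ Completable (gadgetNet E' n S' D') .dst used u c := by
  intro h
  induction h with
  | @finish used u x he hu => cases u <;> simp_all [gadgetNet, GEdge]
  | @step used u v f c c' he hu hf hs _ ih =>
    refine ih (Set.mem_insert_of_mem _ hexit) ?_ ?_
    · rintro rfl
      cases u <;> simp_all [gadgetNet, GEdge]
    · rintro rfl
      simp [gadgetNet, GF] at hf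

theorem stack_eq_nil_of_completable_X {used : Set (GNode V' × GNode V')}
    {x : Proto} {σ : List Proto} (hexit : (.gadget D' 0, .X) ∈ used)
    (h : Completable (gadgetNet E' n S' D') .dst used .X (x, σ)) : σ = [] := by
  cases h with
  | finish => rfl
  | @step _ _ v f _ c' he hu hf hs h =>
    refine (not_completable_of_exit_used (Set.mem_insert_of_mem _ hexit) ?_ ?_ h).elim
    · rintro rfl
      simp [gadgetNet, GEdge] at he
    · rintro rfl
      simp [gadgetNet, GF] at hf

/-- The level-one node `U₁` with two `b` on top of the stack, or `U₂` with one, is a dead end. -/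
theorem not_completable_of_surplus_b {used : Set (GNode V' × GNode V')} {u : GNode V'}
    {c : Proto × List Proto}
    (hc : (∃ U σ, u = .gadget U 0 ∧ c = (.b, .b :: .b :: σ)) ∨
      (∃ U σ, u = .gadget U 1 ∧ c = (.b, .b :: σ))) :
    ¬ Completable (gadgetNet E' n S' D') .dst used u c := by
  intro h
  induction h with
  | @finish used u x he hu => simp at hc
  | @step used u v f c c' he hu hf hs _ ih =>
    apply ih
    rcases hc with ⟨U, σ, rfl, rfl⟩ | ⟨U, σ, rfl, rfl⟩
    · cases v with
      | gadget W i =>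
        fin_cases i <;> simp [gadgetNet, GEdge, GF] at he hf
        · rcases hf with rfl | rfl <;> cases hs
          simp
        · rcases hf with rfl | rfl <;> cases hs
          simp
      | tail i =>
        simp [gadgetNet, GEdge, GF] at he hf
        obtain ⟨rfl, -⟩ := he
        simp at hf
        subst hf
        cases hs
      | X =>
        simp [gadgetNet, GF] at hf
        subst hf
        cases hs
      | dst => simp [gadgetNet, GF] at hf
    · cases v with
      | gadget W i =>
        fin_cases i <;> simp [gadgetNet, GEdge, GF] at he hf
        · rcases hf with rfl | rfl <;> cases hs
          simp
        · rcases hf with rfl | rfl <;> cases hs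
      | tail i => simp [gadgetNet, GEdge] at he
      | X => simp [gadgetNet, GEdge] at he
      | dst => simp [gadgetNet, GF] at hf

theorem completable_first_b {used : Set (GNode V' × GNode V')} {U : V'} {τ : List Proto}
    (h : Completable (gadgetNet E' n S' D') .dst used (.gadget U 0) (.b, .b :: τ)) :
    (.gadget U 0, .gadget U 1) ∉ used ∧
      Completable (gadgetNet E' n S' D') .dst
        (insert (.gadget U 0, .gadget U 1) used) (.gadget U 1) (.b, τ) := by
  cases h with
  | @step _ _ v f _ c' he hu hf hs h =>
    cases v with
    | gadget W i =>
      fin_cases i <;> simp [gadgetNet, GEdge, GF] at he hf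
      · rcases hf with rfl | rfl <;> cases hs
        exact (not_completable_of_surplus_b (.inl ⟨_, _, rfl, rfl⟩) h).elim
      · subst he
        rcases hf with rfl | rfl <;> cases hs
        exact ⟨hu, h⟩
    | tail i =>
      simp [gadgetNet, GEdge, GF] at he hf
      obtain ⟨rfl, -⟩ := he
      simp at hf
      subst hf
      cases hs
    | X =>
      simp [gadgetNet, GF] at hf
      subst hf
      cases hs
    | dst => simp [gadgetNet, GF] at hf

theorem completable_second_b {used : Set (GNode V' × GNode V')} {U : V'} {τ : List Proto}
    (hU : (.gadget U 0, .gadget U 1) ∈ used)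
    (h : Completable (gadgetNet E' n S' D') .dst used (.gadget U 1) (.b, τ)) :
    ∃ ρ, τ = .a :: ρ ∧ Completable (gadgetNet E' n S' D') .dst
        (insert (.gadget U 1, .gadget U 2) used) (.gadget U 2) (.a, ρ) := by
  cases h with
  | finish _ he => simp [gadgetNet, GEdge] at he
  | @step _ _ v f _ c' he hu hf hs h =>
    cases v with
    | gadget W i =>
      fin_cases i <;> simp [gadgetNet, GEdge, GF] at he hf
      · subst he
        rcases hf with rfl | rfl <;> cases hs
        exact ((completable_first_b h).1 (Set.mem_insert_of_mem _ hU)).elim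
      · subst he
        rcases hf with rfl | rfl <;> cases hs
        exact ⟨_, rfl, h⟩
    | tail i => simp [gadgetNet, GEdge] at he
    | X => simp [gadgetNet, GEdge] at he
    | dst => simp [gadgetNet, GF] at hf

theorem completable_second_a {used : Set (GNode V' × GNode V')} {U : V'} {ρ : List Proto}
    (hU : (.gadget U 1, .gadget U 2) ∈ used)
    (h : Completable (gadgetNet E' n S' D') .dst used (.gadget U 1) (.a, ρ)) :
    Completable (gadgetNet E' n S' D') .dst used (.gadget U 0) (.b, .a :: ρ) := by
  cases h with
  | finish _ he => simp [gadgetNet, GEdge] at he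
  | @step _ _ v f _ c' he hu hf hs h =>
    cases v with
    | gadget W i =>
      fin_cases i <;> simp [gadgetNet, GEdge, GF] at he hf
      · subst he
        rcases hf with rfl | rfl <;> cases hs
        exact h.anti (Set.subset_insert _ _)
      · subst he
        exact (hu hU).elim
    | tail i => simp [gadgetNet, GEdge] at he
    | X => simp [gadgetNet, GEdge] at he
    | dst => simp [gadgetNet, GF] at hf

theorem completable_fourth {used : Set (GNode V' × GNode V')} {U : V'} {ρ : List Proto}
    (hU : (.gadget U 2, .gadget U 3) ∈ used) (hU' : (.gadget U 1, .gadget U 2) ∈ used)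
    (h : Completable (gadgetNet E' n S' D') .dst used (.gadget U 3) (.a, ρ)) :
    Completable (gadgetNet E' n S' D') .dst used (.gadget U 0) (.b, .a :: ρ) := by
  cases h with
  | finish _ he => simp [gadgetNet, GEdge] at he
  | @step _ _ v f _ c' he hu hf hs h =>
    cases v with
    | gadget W i =>
      fin_cases i <;> simp [gadgetNet, GEdge, GF] at he hf
      subst he
      rcases hf with rfl | rfl <;> cases hs
      cases h with
      | finish _ he => simp [gadgetNet, GEdge] at he
      | @step _ _ v f _ c' he hu hf hs h =>
        cases v with
        | gadget W i =>
          fin_cases i <;> simp [gadgetNet, GEdge, GF] at he hf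
          · subst he
            rcases hf with rfl | rfl <;> cases hs
            exact (completable_second_a (by simp [hU']) h).anti
              ((Set.subset_insert _ _).trans (Set.subset_insert _ _))
          · subst he
            exact (hu (Set.mem_insert_of_mem _ hU)).elim
        | tail i => simp [gadgetNet, GEdge] at he
        | X => simp [gadgetNet, GEdge] at he
        | dst => simp [gadgetNet, GF] at hf
    | tail i => simp [gadgetNet, GEdge] at he
    | X => simp [gadgetNet, GEdge] at he
    | dst => simp [gadgetNet, GF] at hf

theorem completable_third {used : Set (GNode V' × GNode V')} {U : V'} {τ : List Proto}
    (hU : (.gadget U 1, .gadget U 2) ∈ used)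
    (h : Completable (gadgetNet E' n S' D') .dst used (.gadget U 2) (.a, τ)) :
    ∃ ρ, (τ = ρ ∨ τ = .a :: ρ) ∧
      Completable (gadgetNet E' n S' D') .dst used (.gadget U 0) (.b, .a :: ρ) := by
  cases h with
  | finish _ he => simp [gadgetNet, GEdge] at he
  | @step _ _ v f _ c' he hu hf hs h =>
    cases v with
    | gadget W i =>
      fin_cases i <;> simp [gadgetNet, GEdge, GF] at he hf
      · subst he
        rcases hf with rfl | rfl <;> cases hs
        exact ⟨_, .inl rfl, (completable_second_a (by simp [hU]) h).anti (Set.subset_insert _ _)⟩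
      · subst he
        subst hf
        cases hs
        exact ⟨_, .inr rfl, (completable_fourth (Set.mem_insert _ _)
          (Set.mem_insert_of_mem _ hU) h).anti (Set.subset_insert _ _)⟩
    | tail i => simp [gadgetNet, GEdge] at he
    | X => simp [gadgetNet, GEdge] at he
    | dst => simp [gadgetNet, GF] at hf

/-- A gadget is entered at most once, and its traversal removes at most one `a`. -/
theorem completable_traverse {used : Set (GNode V' × GNode V')} {U : V'} {τ : List Proto}
    (h : Completable (gadgetNet E' n S' D') .dst used (.gadget U 0) (.b, .b :: τ)) :
    (.gadget U 0, .gadget U 1) ∉ used ∧ ∃ ρ, (τ = .a :: ρ ∨ τ = .a :: .a :: ρ) ∧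
      Completable (gadgetNet E' n S' D') .dst
        (insert (.gadget U 0, .gadget U 1) used) (.gadget U 0) (.b, .a :: ρ) := by
  obtain ⟨hU, hsecond⟩ := completable_first_b h
  obtain ⟨σ, rfl, hthird⟩ := completable_second_b (Set.mem_insert _ _) hsecond
  obtain ⟨ρ, hρ, hout⟩ := completable_third (Set.mem_insert _ _) hthird
  refine ⟨hU, ρ, ?_, hout.anti (Set.subset_insert _ _)⟩
  rcases hρ with rfl | rfl <;> simp

theorem completable_leave {used : Set (GNode V' × GNode V')} {U : V'} {ρ : List Proto}
    (hU : (.gadget U 0, .gadget U 1) ∈ used)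
    (h : Completable (gadgetNet E' n S' D') .dst used (.gadget U 0) (.b, .a :: ρ)) :
    (U = D' ∧ ρ = []) ∨ ∃ W, E' U W ∧
      Completable (gadgetNet E' n S' D') .dst used (.gadget W 0) (.b, .b :: .a :: ρ) := by
  cases h with
  | @step _ _ v f _ c' he hu hf hs h =>
    cases v with
    | gadget W i =>
      fin_cases i <;> simp [gadgetNet, GEdge, GF] at he hf
      · rcases hf with rfl | rfl <;> cases hs
        exact .inr ⟨W, he, h.anti (Set.subset_insert _ _)⟩
      · subst he
        exact (hu hU).elim
    | tail i =>
      simp [gadgetNet, GEdge, GF] at he hf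
      obtain ⟨rfl, -⟩ := he
      simp at hf
      subst hf
      cases hs
    | X =>
      simp [gadgetNet, GEdge, GF] at he hf
      subst hf he
      cases hs
      exact .inl ⟨rfl, stack_eq_nil_of_completable_X (Set.mem_insert _ _) h⟩
    | dst => simp [gadgetNet, GF] at hf

theorem exists_path_of_completable [Fintype V'] [DecidableEq V'] {m : ℕ} {visited : Finset V'}
    {U : V'} {k : ℕ} {used : Set (GNode V' × GNode V')} (hm : visitedᶜ.card = m) (hk : m ≤ k)
    (hU : U ∈ visited) (hused : ∀ W ∈ visited, (.gadget W 0, .gadget W 1) ∈ used)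
    (h : Completable (gadgetNet E' n S' D') .dst used (.gadget U 0)
      (.b, .a :: List.replicate k .a)) :
    ∃ l : List V', (U :: l).IsChain E' ∧ (U :: l).getLast? = some D' ∧ l.Nodup ∧
      ∀ v, v ∈ l ↔ v ∉ visited := by
  induction m generalizing visited U k used with
  | zero =>
    have huniv : visited = Finset.univ := by simpa using hm
    subst huniv
    rcases completable_leave (hused U hU) h with ⟨rfl, -⟩ | ⟨W, -, h⟩
    · exact ⟨[], by simp⟩
    · exact ((completable_traverse h).1 (hused W (by simp))).elim
  | succ m ih =>
    rcases completable_leave (hused U hU) h with ⟨-, hnil⟩ | ⟨W, hUW, h⟩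
    · simp at hnil
      omega
    · obtain ⟨hW, ρ, hρ, h⟩ := completable_traverse h
      have hWv : W ∉ visited := fun hmem => hW (hused W hmem)
      obtain ⟨k', hk', rfl⟩ : ∃ k', m ≤ k' ∧ ρ = List.replicate k' .a := by
        obtain ⟨j, rfl⟩ : ∃ j, k = j + 1 := ⟨k - 1, by omega⟩
        rcases hρ with hρ | hρ
        · exact ⟨j + 1, by omega, by simpa using hρ.symm⟩
        · exact ⟨j, by omega, by simpa [List.replicate_succ] using hρ.symm⟩
      have hcard : (insert W visited)ᶜ.card = m := by
        rw [Finset.card_compl, Finset.card_insert_of_notMem hWv]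
        rw [Finset.card_compl] at hm
        omega
      obtain ⟨l, hchain, hlast, hnodup, hmem⟩ := ih hcard hk' (Finset.mem_insert_self _ _)
        (fun w hw => by
          rcases Finset.mem_insert.1 hw with rfl | hw
          · exact Set.mem_insert _ _
          · exact Set.mem_insert_of_mem _ (hused w hw)) h
      refine ⟨W :: l, hchain.cons_cons hUW, by simpa using hlast, ?_, ?_⟩
      · simp [hnodup, hmem]
      · intro v
        by_cases hv : v = W <;> simp [hmem, hv, hWv]

theorem not_completable_tail_of_used {i : ℕ} (hi : i ≤ n) {used : Set (GNode V' × GNode V')}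
    {c : Proto × List Proto} (hused : ∀ j ≤ i, (.tail j, .tail (j + 1)) ∈ used) :
    ¬ Completable (gadgetNet E' n S' D') .dst used (.tail i) c := by
  intro h
  induction i generalizing used c with
  | zero =>
    cases h with
    | finish _ he => simp [gadgetNet, GEdge] at he
    | @step _ _ v f _ c' he hu hf hs h =>
      cases v <;> simp [gadgetNet, GEdge] at he
      obtain ⟨rfl, -⟩ := he
      exact hu (hused 0 le_rfl)
  | succ i ih =>
    cases h with
    | finish _ he => simp [gadgetNet, GEdge] at he
    | @step _ _ v f _ c' he hu hf hs h =>
      cases v <;> simp [gadgetNet, GEdge] at he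
      · omega
      · obtain ⟨rfl | rfl, -⟩ := he
        · exact hu (hused _ le_rfl)
        · exact ih (by omega) (fun j hj => Set.mem_insert_of_mem _ (hused j (by omega))) h

theorem completable_start_of_tail {i m : ℕ} (hi : i + m = n) {used : Set (GNode V' × GNode V')}
    (hused : ∀ j < i, (.tail j, .tail (j + 1)) ∈ used)
    (h : Completable (gadgetNet E' n S' D') .dst used (.tail i) (.a, List.replicate i .a)) :
    Completable (gadgetNet E' n S' D') .dst ∅ (.gadget S' 0)
      (.b, .b :: List.replicate (n + 1) .a) := by
  induction m generalizing i used with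
  | zero =>
    obtain rfl : i = n := by omega
    generalize hc : (Proto.a, List.replicate i Proto.a) = c at h
    cases h with
    | finish _ he => simp [gadgetNet, GEdge] at he
    | @step _ _ v f _ c' he hu hf hs h =>
      subst hc
      cases v <;> simp [gadgetNet, GEdge, GF] at he hf
      obtain ⟨rfl | rfl, -⟩ := he
      · simp at hf
        subst hf
        cases hs
        generalize hc : (Proto.b, Proto.a :: List.replicate i Proto.a) = c at h
        cases h with
        | finish _ he => simp [gadgetNet, GEdge] at he
        | @step _ _ v f _ c' he hu hf hs h =>
          subst hc
          cases v with
          | gadget W j =>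
            simp [gadgetNet, GEdge] at he
            obtain ⟨rfl, rfl⟩ := he
            simp [gadgetNet, GF] at hf
            rcases hf with rfl | rfl <;> cases hs
            exact h.anti (Set.empty_subset _)
          | tail j =>
            simp only [gadgetNet, GF] at hf
            split_ifs at hf <;> simp at hf <;> subst hf <;> cases hs
          | X => simp [gadgetNet, GEdge] at he
          | dst => simp [gadgetNet, GEdge] at he
      · exact (not_completable_tail_of_used (by omega)
          (fun j hj => Set.mem_insert_of_mem _ (hused j (by omega))) h).elim
  | succ m ih =>
    generalize hc : (Proto.a, List.replicate i Proto.a) = c at h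
    cases h with
    | finish _ he => simp [gadgetNet, GEdge] at he
    | @step _ _ v f _ c' he hu hf hs h =>
      subst hc
      cases v with
      | gadget W j =>
        simp [gadgetNet, GEdge] at he
        omega
      | tail j =>
        simp [gadgetNet, GEdge, GF] at he hf
        obtain ⟨rfl | rfl, -⟩ := he
        · have : i + 1 ≤ n := by omega
          simp [this] at hf
          subst hf
          cases hs
          refine ih (by omega) (fun j hj => ?_) h
          rcases Nat.lt_succ_iff_lt_or_eq.1 hj with hj | rfl
          · exact Set.mem_insert_of_mem _ (hused j hj)
          · exact Set.mem_insert _ _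
        · exact (not_completable_tail_of_used (by omega)
            (fun j hj => Set.mem_insert_of_mem _ (hused j (by omega))) h).elim
      | X => simp [gadgetNet, GEdge] at he
      | dst => simp [gadgetNet, GEdge] at he

/-! ### Construction of a path -/

theorem completable_of_traverse {W : V'} {used : Set (GNode V' × GNode V')} {ρ : List Proto}
    (hW : ∀ i j, i ≠ j → (.gadget W i, .gadget W j) ∉ used)
    (h : ∀ used' : Set (GNode V' × GNode V'),
      (∀ e ∈ used', e ∈ used ∨ ∃ i j, i ≠ j ∧ e = (.gadget W i, .gadget W j)) →
      Completable (gadgetNet E' n S' D') .dst used' (.gadget W 0) (.b, .a :: ρ)) :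
    Completable (gadgetNet E' n S' D') .dst used (.gadget W 0) (.b, .b :: .a :: .a :: ρ) := by
  refine .step (v := .gadget W 1) (f := .decap .b .b) (by simp [gadgetNet, GEdge]) (by simp [hW])
    (by simp [gadgetNet, GF]) (.decap _ _ _) ?_
  refine .step (v := .gadget W 2) (f := .decap .a .b) (by simp [gadgetNet, GEdge]) (by simp [hW])
    (by simp [gadgetNet, GF]) (.decap _ _ _) ?_
  refine .step (v := .gadget W 3) (f := .decap .a .a) (by simp [gadgetNet, GEdge]) (by simp [hW])
    (by simp [gadgetNet, GF]) (.decap _ _ _) ?_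
  refine .step (v := .gadget W 2) (f := .conv .a .a) (by simp [gadgetNet, GEdge]) (by simp [hW])
    (by simp [gadgetNet, GF]) (.conv _ _ _) ?_
  refine .step (v := .gadget W 1) (f := .conv .a .a) (by simp [gadgetNet, GEdge]) (by simp [hW])
    (by simp [gadgetNet, GF]) (.conv _ _ _) ?_
  refine .step (v := .gadget W 0) (f := .encap .a .b) (by simp [gadgetNet, GEdge]) (by simp [hW])
    (by simp [gadgetNet, GF]) (.encap _ _ _) ?_
  refine h _ ?_
  rintro e (rfl | rfl | rfl | rfl | rfl | rfl | he)
  iterate 6 exact .inr ⟨_, _, by decide, rfl⟩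
  exact .inl he

theorem completable_of_path {U : V'} {l : List V'} {used : Set (GNode V' × GNode V')}
    (hchain : (U :: l).IsChain E') (hlast : (U :: l).getLast? = some D') (hnodup : (U :: l).Nodup)
    (hl : ∀ W ∈ l, ∀ i y, (.gadget W i, y) ∉ used) (hX : ∀ y, (.X, y) ∉ used)
    (hUX : (.gadget U 0, .X) ∉ used) (hU : ∀ W, (.gadget U 0, .gadget W 0) ∉ used) :
    Completable (gadgetNet E' n S' D') .dst used (.gadget U 0)
      (.b, .a :: List.replicate l.length .a) := by
  induction l generalizing U used with
  | nil =>
    obtain rfl : U = D' := by simpa using hlast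
    refine .step (v := .X) (f := .decap .a .b) (by simp [gadgetNet, GEdge])
      hUX (by simp [gadgetNet, GF]) (.decap _ _ _) (.finish .a (by simp [gadgetNet, GEdge]) ?_)
    simpa using hX _
  | cons W l ih =>
    have hUW : U ≠ W := by
      rintro rfl
      simp at hnodup
    have hW := hl W (by simp)
    rw [List.isChain_cons_cons] at hchain
    have hWl : W ∉ l := (List.nodup_cons.1 (List.nodup_cons.1 hnodup).2).1
    have hUl : U ∉ l := fun h => (List.nodup_cons.1 hnodup).1 (List.mem_cons_of_mem _ h)
    refine .step (v := .gadget W 0) (f := .encap .b .b) (by simp [gadgetNet, GEdge, hchain.1])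
      (hU W) (by simp [gadgetNet, GF]) (.encap _ _ _) ?_
    refine completable_of_traverse (by simp [hW, hUW.symm]) fun used' hused' => ?_
    refine ih hchain.2 (by simpa using hlast) (List.nodup_cons.1 hnodup).2 ?_ ?_ ?_ ?_
    · intro Y hY i y hy
      have hYW : Y ≠ W := fun h => hWl (h ▸ hY)
      have hYU : Y ≠ U := fun h => hUl (h ▸ hY)
      simpa [hl Y (List.mem_cons_of_mem _ hY), hYW, hYU] using hused' _ hy
    · intro y hy
      simpa [hX] using hused' _ hy
    · intro hy
      simpa [hW, hUW.symm] using hused' _ hy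
    · intro Y hy
      have := hused' _ hy
      simp [hW, hUW.symm] at this

theorem completable_tail {i m : ℕ} (hi : i + m = n) {used : Set (GNode V' × GNode V')}
    (hused : ∀ e ∈ used, ∃ j < i, e.1 = .tail j)
    (h : ∀ used' : Set (GNode V' × GNode V'), (∀ e ∈ used', ∃ j, e.1 = .tail j) →
      Completable (gadgetNet E' n S' D') .dst used' (.gadget S' 0)
        (.b, .b :: List.replicate (n + 1) .a)) :
    Completable (gadgetNet E' n S' D') .dst used (.tail i) (.a, List.replicate i .a) := by
  have hnot : ∀ y, (.tail i, y) ∉ used := by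
    intro y hy
    obtain ⟨j, hj, he⟩ := hused _ hy
    cases he
    omega
  induction m generalizing i used with
  | zero =>
    obtain rfl : i = n := by omega
    have hnot' : ∀ y, (.tail (i + 1), y) ∉ used := by
      intro y hy
      obtain ⟨j, hj, he⟩ := hused _ hy
      cases he
      omega
    refine .step (v := .tail (i + 1)) (f := .encap .a .b) (by simp [gadgetNet, GEdge]) (hnot _)
      (by simp [gadgetNet, GF]) (.encap _ _ _) ?_
    refine .step (v := .gadget S' 0) (f := .encap .b .b) (by simp [gadgetNet, GEdge])
      (by simp [hnot']) (by simp [gadgetNet, GF]) (.encap _ _ _) (h _ ?_)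
    rintro e (rfl | rfl | he)
    · exact ⟨_, rfl⟩
    · exact ⟨_, rfl⟩
    · obtain ⟨j, -, hj⟩ := hused e he
      exact ⟨j, hj⟩
  | succ m ih =>
    have hin : i + 1 ≤ n := by omega
    have hused' : ∀ e ∈ insert (.tail i, .tail (i + 1)) used, ∃ j < i + 1, e.1 = .tail j := by
      rintro e (rfl | he)
      · exact ⟨i, by omega, rfl⟩
      · obtain ⟨j, hj, he⟩ := hused e he
        exact ⟨j, by omega, he⟩
    refine .step (v := .tail (i + 1)) (f := .encap .a .a) (by simp [gadgetNet, GEdge]; omega)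
      (hnot _) (by simp [gadgetNet, GF, hin]) (.encap _ _ _) (ih (by omega) hused' ?_)
    intro y hy
    obtain ⟨j, hj, he⟩ := hused' _ hy
    cases he
    omega

end GadgetNet

/-- **Proposition 1, reduction.** Let `(V', E')` be a finite symmetric
directed graph with nodes `S', D'` and `n = |V'|`, and let `N` be the gadget
multi-layer network built from it. Then `(V', E')` contains a directed Hamiltonian
path from `S'` to `D'` iff `N` contains a feasible path from `S` to `D` (source
protocol `a`) traversing each arc at most once. -/
theorem sym_ham_iff_feasible_arc_once {V' : Type*} [Fintype V'] [DecidableEq V']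
    (E' : V' → V' → Prop) (hsym : ∀ u v : V', E' u v ↔ E' v u) (S' D' : V') :
    (∃ l : List V', IsDirHamPath E' S' D' l) ↔
      (∃ steps : List (GNode V' × AdaptFn Proto),
        IsFeasiblePath (gadgetNet E' (Fintype.card V') S' D') (.tail 0) .dst .a steps ∧
        ArcsOnce (nodeSeq (GNode.tail 0) GNode.dst steps)) := by
  rw [exists_feasible_arc_once_iff_completable]
  constructor
  · rintro ⟨l, hhead, hlast, hchain, hnodup, hmem⟩
    have hlen : l.length = Fintype.card V' := by
      rw [← List.toFinset_card_of_nodup hnodup, ← Finset.card_univ]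
      congr 1
      ext v
      simp [hmem]
    obtain ⟨l, rfl⟩ : ∃ l', l = S' :: l' := by
      cases l <;> simp_all
    refine GadgetNet.completable_tail (m := Fintype.card V') (zero_add _) (by simp) ?_
    intro used hused
    have hnot : ∀ u y, (∀ j, u ≠ .tail j) → (u, y) ∉ used := fun u y hu hy => by
      obtain ⟨j, hj⟩ := hused _ hy
      exact hu j hj
    rw [← hlen, List.length_cons, List.replicate_succ, List.replicate_succ]
    refine GadgetNet.completable_of_traverse (by simp [hnot]) fun used' hused' => ?_
    refine GadgetNet.completable_of_path hchain hlast hnodup ?_ ?_ ?_ ?_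
    · intro W hW i y hy
      have hWS : W ≠ S' := by
        rintro rfl
        exact (List.nodup_cons.1 hnodup).1 hW
      simpa [hnot, hWS] using hused' _ hy
    · intro y hy
      simpa [hnot] using hused' _ hy
    · intro hy
      simpa [hnot] using hused' _ hy
    · intro W hy
      have := hused' _ hy
      simp [hnot] at this
  · intro h
    have h := GadgetNet.completable_start_of_tail (i := 0) (m := Fintype.card V') (zero_add _)
      (by simp) h
    obtain ⟨-, ρ, hρ, h⟩ := GadgetNet.completable_traverse h
    have hpos : 0 < Fintype.card V' := Fintype.card_pos_iff.2 ⟨S'⟩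
    obtain ⟨k, hk, rfl⟩ : ∃ k, Fintype.card V' - 1 ≤ k ∧ ρ = List.replicate k .a := by
      obtain ⟨j, hj⟩ : ∃ j, Fintype.card V' = j + 1 := ⟨Fintype.card V' - 1, by omega⟩
      rw [hj] at hρ ⊢
      rcases hρ with hρ | hρ
      · exact ⟨j + 1, by omega, by simpa [List.replicate_succ] using hρ.symm⟩
      · exact ⟨j, by omega, by simpa [List.replicate_succ] using hρ.symm⟩
    obtain ⟨l, hchain, hlast, hnodup, hmem⟩ := GadgetNet.exists_path_of_completable
      (visited := {S'}) (by rw [Finset.card_compl, Finset.card_singleton]) hk (by simp)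
      (by simp) h
    refine ⟨S' :: l, rfl, hlast, hchain, by simp [hnodup, hmem], fun v => ?_⟩
    by_cases hv : v = S' <;> simp [hv, hmem]
end

section
/- Let H=(V',E') be a finite symmetric directed graph with distinguished nodes S', D' ∈ V', n = |V'|, and let N be the gadget multi-layer network over protocols A={a,b} constructed from H with source S and destination D. If H contains a directed Hamiltonian path from S' to D', then the path in N obtained by traversing the tail S=C_0, C_1 (a→aa), ..., C_n (a→aa), C_{n+1} (a→ab), then, following the node order U'(1)=S', U'(2), ..., U'(n)=D' of the Hamiltonian path, replacing each node U' by the node/function sequence U_1 (b→bb) U_2 dec(b→bb) U_3 dec(a→ab) U_4 dec(a→aa) U_3 (a→a) U_2 (a→a) U_1 (a→ab), and finally crossing X with dec(a→ab) to reach D, is a feasible path from S to D (with source protocol a) that traverses each arc of N at most once. -/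
theorem Run.append {V A : Type*} {N : MLNetwork V A} {c c' c'' : A × List A}
    {s t : List (V × AdaptFn A)} (hs : Run N c s c') (ht : Run N c' t c'') :
    Run N c (s ++ t) c'' := by
  induction hs with
  | nil _ => exact ht
  | cons hf hstep _ ih => exact .cons hf hstep (ih ht)

theorem Run.single {V A : Type*} {N : MLNetwork V A} {U : V} {f : AdaptFn A}
    {c c' : A × List A} (hf : f ∈ N.F U) (h : AdaptStep f c c') : Run N c [(U, f)] c' :=
  .cons hf h (.nil _)

theorem ArcsOnce.cons {V : Type*} {x : V} {l : List V} (hx : x ∉ l) (hl : ArcsOnce l) :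
    ArcsOnce (x :: l) := by
  cases l with
  | nil => simp [ArcsOnce]
  | cons y l => exact List.nodup_cons.2 ⟨fun h => hx (List.of_mem_zip h).1, hl⟩

theorem ArcsOnce.append {V : Type*} {p l : List V} (hp : p.Nodup) (hd : p.Disjoint l)
    (hl : ArcsOnce l) : ArcsOnce (p ++ l) := by
  induction p with
  | nil => exact hl
  | cons x p ih =>
    rw [List.nodup_cons] at hp
    rw [List.disjoint_cons_left] at hd
    exact (ih hp.2 hd.2).cons (by simp [hp.1, hd.1])

/-- The nodes visited by `gadgetSeq U`. -/
def gadgetNodes {V' : Type*} (U : V') : List (GNode V') :=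
  (gadgetSeq U).map Prod.fst

theorem nodeSeq_hamSteps {V' : Type*} (n : ℕ) (l : List V') :
    nodeSeq (.tail 0) .dst (hamSteps n l) =
      (List.range (n + 2)).map GNode.tail ++ (l.flatMap gadgetNodes ++ [.X, .dst]) := by
  have htail : (List.range (n + 2)).map (GNode.tail (V' := V')) =
      .tail 0 :: ((List.range n).map fun i => .tail (i + 1)) ++ [.tail (n + 1)] := by
    rw [List.range_succ, List.range_succ_eq_map]
    simp [Function.comp_def]
  rw [htail]
  simp [nodeSeq, hamSteps, tailSteps, List.map_flatMap, Function.comp_def]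
  rfl

theorem arcsOnce_gadgets {V' : Type*} {l : List V'} (hl : l.Nodup) :
    ArcsOnce (l.flatMap gadgetNodes ++ [.X, .dst]) := by
  induction l with
  | nil => simp [ArcsOnce]
  | cons U l ih =>
    rw [List.nodup_cons] at hl
    have ih := ih hl.2
    have hU : ∀ i, GNode.gadget U i ∉ l.flatMap gadgetNodes ++ [.X, .dst] := by
      intro i hi
      simp only [List.mem_append, List.mem_flatMap, gadgetNodes, gadgetSeq, List.map_cons,
        List.map_nil, List.mem_cons, GNode.gadget.injEq, reduceCtorEq, List.not_mem_nil,
        or_false] at hi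
      grind
    rw [List.flatMap_cons, List.append_assoc]
    generalize l.flatMap gadgetNodes ++ [.X, .dst] = r at ih hU
    cases r with
    | nil => simp [ArcsOnce, gadgetNodes, gadgetSeq]
    | cons y r =>
      have hz : ∀ i z, (GNode.gadget U i, z) ∉ (y :: r).zip r :=
        fun i z h => hU i (List.of_mem_zip h).1
      have hy : ∀ i, GNode.gadget U i ≠ y := fun i h => hU i (by simp [h])
      have ih : ((y :: r).zip r).Nodup := ih
      simp [ArcsOnce, gadgetNodes, gadgetSeq, hz, hy, ih]

theorem isChain_gadgets {V' : Type*} {E' : V' → V' → Prop} {n : ℕ} {S' D' : V'} {l : List V'}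
    (hlast : l.getLast? = some D') (hl : l.IsChain E') :
    (l.flatMap gadgetNodes ++ [GNode.X, GNode.dst]).IsChain (GEdge E' n S' D') := by
  induction l with
  | nil => simp at hlast
  | cons U l ih =>
    cases l with
    | nil =>
      obtain rfl : U = D' := by simpa using hlast
      simp [gadgetNodes, gadgetSeq, GEdge]
    | cons W l =>
      rw [List.isChain_cons_cons] at hl
      have ih := ih (by simpa using hlast) hl.2
      simp only [List.flatMap_cons, gadgetNodes, gadgetSeq, List.map_cons, List.map_nil,
        List.cons_append, List.nil_append] at ih ⊢
      simpa [GEdge, hl.1] using ih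

theorem isChain_tail {V' : Type*} {E' : V' → V' → Prop} {n : ℕ} {S' D' : V'} :
    ((List.range (n + 2)).map GNode.tail).IsChain (GEdge E' n S' D') := by
  rw [List.isChain_map, List.isChain_iff_getElem]
  intro i hi
  simp at hi
  simp [GEdge]
  omega

theorem run_tailSteps {V' : Type*} {E' : V' → V' → Prop} {n : ℕ} {S' D' : V'} :
    Run (gadgetNet E' n S' D') (.a, []) (tailSteps n) (.b, List.replicate (n + 1) .a) := by
  have h : ∀ k ≤ n, Run (gadgetNet E' n S' D') (.a, [])
      ((List.range k).map fun i => (GNode.tail (i + 1), AdaptFn.encap Proto.a Proto.a))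
      (.a, List.replicate k .a) := by
    intro k hk
    induction k with
    | zero => exact .nil _
    | succ k ih =>
      rw [List.range_succ, List.map_append]
      exact (ih (by omega)).append (.single (by simp [gadgetNet, GF, hk]) (.encap _ _ _))
  exact (h n le_rfl).append (.single (by simp [gadgetNet, GF]) (.encap _ _ _))

theorem run_gadgetSeq {V' : Type*} {E' : V' → V' → Prop} {n : ℕ} {S' D' : V'} (U : V')
    (σ : List Proto) :
    Run (gadgetNet E' n S' D') (.b, .a :: .a :: σ) (gadgetSeq U) (.b, .a :: σ) := by
  refine .cons ?_ (.encap _ _ _) <| .cons ?_ (.decap _ _ _) <| .cons ?_ (.decap _ _ _) <|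
    .cons ?_ (.decap _ _ _) <| .cons ?_ (.conv _ _ _) <| .cons ?_ (.conv _ _ _) <|
    .single ?_ (.encap _ _ _) <;> simp [gadgetNet, GF]

theorem run_gadgets {V' : Type*} {E' : V' → V' → Prop} {n : ℕ} {S' D' : V'} (l : List V') :
    Run (gadgetNet E' n S' D') (.b, List.replicate (l.length + 1) .a) (l.flatMap gadgetSeq)
      (.b, [.a]) := by
  induction l with
  | nil => exact .nil _
  | cons U l ih => exact (run_gadgetSeq U _).append ih

/-- If the symmetric digraph `(V', E')` contains a directed
Hamiltonian path from `S'` to `D'` with vertex sequence `l`, then the path of the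
gadget network obtained by traversing the tail (`C₁ (a→aa) ... Cₙ (a→aa)
C_{n+1} (a→ab)`), then one `gadgetSeq` per node of `l` in order, and finally
crossing `X` with `dec(a→ab)` to reach `D`, is a feasible path from `S` to `D`
(source protocol `a`) traversing each arc of the network at most once. -/
theorem ham_gives_feasible_arc_once {V' : Type*} [Fintype V'] [DecidableEq V']
    (E' : V' → V' → Prop) (hsym : ∀ u v : V', E' u v ↔ E' v u) (S' D' : V')
    (l : List V') (hham : IsDirHamPath E' S' D' l) :
    IsFeasiblePath (gadgetNet E' (Fintype.card V') S' D') (.tail 0) .dst .a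
      (hamSteps (Fintype.card V') l) ∧
    ArcsOnce (nodeSeq (GNode.tail 0) GNode.dst (hamSteps (Fintype.card V') l)) := by
  obtain ⟨hhead, hlast, hchain, hnodup, hall⟩ := hham
  have hlen : Fintype.card V' = l.length := by
    rw [← Finset.card_univ, ← List.toFinset_card_of_nodup hnodup]
    congr 1
    ext v
    simp [hall v]
  refine ⟨⟨?_, .a, ?_⟩, ?_⟩
  · rw [nodeSeq_hamSteps]
    refine List.IsChain.append isChain_tail (isChain_gadgets hlast hchain) ?_
    obtain ⟨t, rfl⟩ : ∃ t, l = S' :: t := by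
      cases l <;> simp_all
    simp [List.range_succ, gadgetNodes, gadgetSeq, gadgetNet, GEdge]
  · rw [hlen]
    exact (run_tailSteps.append (run_gadgets l)).append
      (.single (by simp [gadgetNet, GF]) (.decap _ _ _))
  · rw [nodeSeq_hamSteps]
    refine ArcsOnce.append ?_ ?_ (arcsOnce_gadgets hnodup)
    · exact List.nodup_range.map fun _ _ h => GNode.tail.inj h
    · simp [List.Disjoint, gadgetNodes, gadgetSeq]
end

section
/- Let H=(V',E') be a finite symmetric directed graph with distinguished nodes S', D' ∈ V', n = |V'|, and let N be the gadget multi-layer network over protocols A={a,b} constructed from H with source S and destination D. If N contains a feasible path P from S to D (with source protocol a) that traverses each arc of N at most once, then P contains, for every U' ∈ V', exactly one occurrence of the node/function sequence U_1 (b→bb) U_2 dec(b→bb) U_3 dec(a→ab) U_4 dec(a→aa) U_3 (a→a) U_2 (a→a) U_1 (a→ab), and replacing each such occurrence by the corresponding node U' (and discarding the tail portion and the nodes X and D) yields a directed Hamiltonian path from S' to D' in H. -/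
/-- The arcs traversed by the path that starts at `v`, crosses `steps` and ends at `D`. -/
def arcs {V A : Type*} (D v : V) (steps : List (V × AdaptFn A)) : List (V × V) :=
  (nodeSeq v D steps).zip (nodeSeq v D steps).tail

@[simp]
lemma arcs_nil {V A : Type*} (D v : V) :
    arcs D v ([] : List (V × AdaptFn A)) = [(v, D)] := rfl

@[simp]
lemma arcs_cons {V A : Type*} (D v U : V) (f : AdaptFn A) (steps : List (V × AdaptFn A)) :
    arcs D v ((U, f) :: steps) = (v, U) :: arcs D U steps := rfl

/-- A feasible walk from `v` in configuration `c` to `D` with empty final stack,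
traversing no arc twice. -/
inductive ArcTrail {V A : Type*} (N : MLNetwork V A) (D : V) :
    V → A × List A → List (V × AdaptFn A) → Prop
  | nil {v : V} (x : A) : N.Edge v D → ArcTrail N D v (x, []) []
  | cons {v U : V} {f : AdaptFn A} {c c' : A × List A} {rest : List (V × AdaptFn A)} :
      N.Edge v U → f ∈ N.F U → AdaptStep f c c' → (v, U) ∉ arcs D U rest →
      ArcTrail N D U c' rest → ArcTrail N D v c ((U, f) :: rest)

lemma Run.arcTrail {V A : Type*} {N : MLNetwork V A} {D v : V} {c : A × List A} {x : A}
    {steps : List (V × AdaptFn A)} (hrun : Run N c steps (x, []))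
    (hchain : (nodeSeq v D steps).IsChain N.Edge) (honce : (arcs D v steps).Nodup) :
    ArcTrail N D v c steps := by
  induction steps generalizing v c with
  | nil =>
    cases hrun
    exact .nil x (by simpa [nodeSeq] using hchain)
  | cons s rest ih =>
    cases hrun with
    | cons hf hs hr =>
      rw [arcs_cons, List.nodup_cons] at honce
      simp only [nodeSeq, List.map_cons, List.cons_append, List.isChain_cons_cons] at hchain
      exact .cons hchain.1 hf hs honce.1 (ih hr hchain.2 honce.2)

/-- If the arc `(p, q)` is the only one leaving `K`, then every trail from inside `K` that
reaches a node outside `K` traverses it. -/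
lemma ArcTrail.mem_arcs_of_cut {V A : Type*} {N : MLNetwork V A} {D v p q : V}
    {c : A × List A} {steps : List (V × AdaptFn A)} (h : ArcTrail N D v c steps)
    (K : V → Prop) (hK : ∀ x y, N.Edge x y → K x → ¬ K y → x = p ∧ y = q) (hv : K v)
    {x y : V} (hxy : (x, y) ∈ arcs D v steps) (hy : ¬ K y) : (p, q) ∈ arcs D v steps := by
  induction h with
  | nil _ hE =>
    simp only [arcs_nil, List.mem_singleton, Prod.mk.injEq] at hxy ⊢
    obtain ⟨rfl, rfl⟩ := hxy
    obtain ⟨rfl, rfl⟩ := hK _ _ hE hv hy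
    exact ⟨rfl, rfl⟩
  | @cons v U _ _ _ rest hE _ _ _ _ ih =>
    rw [arcs_cons, List.mem_cons] at hxy ⊢
    by_cases hU : K U
    · rcases hxy with hxy | hxy
      · obtain ⟨rfl, rfl⟩ := Prod.mk.inj hxy
        exact absurd hU hy
      · exact .inr (ih hU hxy)
    · obtain ⟨rfl, rfl⟩ := hK _ _ hE hv hU
      exact .inl rfl

lemma ArcTrail.exists_mem_arcs {V A : Type*} {N : MLNetwork V A} {D v : V}
    {c : A × List A} {steps : List (V × AdaptFn A)} (h : ArcTrail N D v c steps) :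
    ∃ x, (x, D) ∈ arcs D v steps := by
  induction h with
  | @nil v _ _ => exact ⟨v, by simp⟩
  | cons _ _ _ _ _ ih => exact ih.imp fun _ hx => by simp [hx]

section Gadget

variable {V' : Type*} {E' : V' → V' → Prop} {n : ℕ} {S' D' : V'}

lemma edge_gadget_zero {U : V'} {W : GNode V'} (h : (gadgetNet E' n S' D').Edge (.gadget U 0) W) :
    W = .gadget U 1 ∨ (∃ V, W = .gadget V 0 ∧ E' U V) ∨ W = .tail (n + 1) ∨
      (W = .X ∧ U = D') := by
  rcases W with ⟨W, j⟩ | i | _ | _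
  · fin_cases j <;> simp_all [gadgetNet, GEdge]
  all_goals simp_all [gadgetNet, GEdge]

lemma edge_gadget_one {U : V'} {W : GNode V'} (h : (gadgetNet E' n S' D').Edge (.gadget U 1) W) :
    W = .gadget U 0 ∨ W = .gadget U 2 := by
  rcases W with ⟨W, j⟩ | i | _ | _
  · fin_cases j <;> simp_all [gadgetNet, GEdge]
  all_goals simp_all [gadgetNet, GEdge]

lemma edge_gadget_two {U : V'} {W : GNode V'} (h : (gadgetNet E' n S' D').Edge (.gadget U 2) W) :
    W = .gadget U 1 ∨ W = .gadget U 3 := by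
  rcases W with ⟨W, j⟩ | i | _ | _
  · fin_cases j <;> simp_all [gadgetNet, GEdge]
  all_goals simp_all [gadgetNet, GEdge]

lemma edge_gadget_three {U : V'} {W : GNode V'} (h : (gadgetNet E' n S' D').Edge (.gadget U 3) W) :
    W = .gadget U 2 := by
  rcases W with ⟨W, j⟩ | i | _ | _
  · fin_cases j <;> simp_all [gadgetNet, GEdge]
  all_goals simp_all [gadgetNet, GEdge]

lemma edge_to_gadget_three {U : V'} {W : GNode V'}
    (h : (gadgetNet E' n S' D').Edge W (.gadget U 3)) :
    W = .gadget U 2 := by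
  rcases W with ⟨W, j⟩ | i | _ | _
  · fin_cases j <;> simp_all [gadgetNet, GEdge]
  all_goals simp_all [gadgetNet, GEdge]

lemma edge_X {W : GNode V'} (h : (gadgetNet E' n S' D').Edge .X W) :
    W = .gadget D' 0 ∨ W = .dst := by
  rcases W with ⟨W, j⟩ | i | _ | _ <;> simp_all [gadgetNet, GEdge]

lemma edge_tail {i : ℕ} (hi : i ≤ n) {W : GNode V'}
    (h : (gadgetNet E' n S' D').Edge (.tail i) W) :
    W = .tail (i + 1) ∨ ∃ j, i = j + 1 ∧ W = .tail j := by
  rcases W with ⟨W, j⟩ | j | _ | _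
  · simp only [gadgetNet, GEdge] at h; omega
  · obtain ⟨rfl | rfl, -⟩ := h <;> simp
  all_goals simp_all [gadgetNet, GEdge]

lemma edge_tail_last {W : GNode V'} (h : (gadgetNet E' n S' D').Edge (.tail (n + 1)) W) :
    W = .gadget S' 0 ∨ ∃ i, W = .tail i := by
  rcases W with ⟨W, j⟩ | j | _ | _ <;> simp_all [gadgetNet, GEdge]

lemma cross_gadget_zero_b {U : V'} {f : AdaptFn Proto} {σ : List Proto}
    {c : Proto × List Proto} (hf : f ∈ (gadgetNet E' n S' D').F (.gadget U 0))
    (h : AdaptStep f (.b, σ) c) :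
    f = .encap .b .b ∧ c = (.b, .b :: σ) := by
  cases h <;> simp_all [gadgetNet, GF]

lemma cross_gadget_zero_a {U : V'} {f : AdaptFn Proto} {σ : List Proto}
    {c : Proto × List Proto} (hf : f ∈ (gadgetNet E' n S' D').F (.gadget U 0))
    (h : AdaptStep f (.a, σ) c) :
    f = .encap .a .b ∧ c = (.b, .a :: σ) := by
  cases h <;> simp_all [gadgetNet, GF]

lemma cross_gadget_one_b {U : V'} {f : AdaptFn Proto} {σ : List Proto}
    {c : Proto × List Proto} (hf : f ∈ (gadgetNet E' n S' D').F (.gadget U 1))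
    (h : AdaptStep f (.b, σ) c) :
    ∃ τ, σ = .b :: τ ∧ f = .decap .b .b ∧ c = (.b, τ) := by
  cases h <;> simp_all [gadgetNet, GF]

lemma cross_gadget_one_a {U : V'} {f : AdaptFn Proto} {σ : List Proto}
    {c : Proto × List Proto} (hf : f ∈ (gadgetNet E' n S' D').F (.gadget U 1))
    (h : AdaptStep f (.a, σ) c) :
    f = .conv .a .a ∧ c = (.a, σ) := by
  cases h <;> simp_all [gadgetNet, GF]

lemma cross_gadget_two_b {U : V'} {f : AdaptFn Proto} {σ : List Proto}
    {c : Proto × List Proto} (hf : f ∈ (gadgetNet E' n S' D').F (.gadget U 2))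
    (h : AdaptStep f (.b, σ) c) :
    ∃ τ, σ = .a :: τ ∧ f = .decap .a .b ∧ c = (.a, τ) := by
  cases h <;> simp_all [gadgetNet, GF]

lemma cross_gadget_two_a {U : V'} {f : AdaptFn Proto} {σ : List Proto}
    {c : Proto × List Proto} (hf : f ∈ (gadgetNet E' n S' D').F (.gadget U 2))
    (h : AdaptStep f (.a, σ) c) :
    f = .conv .a .a ∧ c = (.a, σ) := by
  cases h <;> simp_all [gadgetNet, GF]

lemma cross_gadget_three {U : V'} {f : AdaptFn Proto} {x : Proto} {σ : List Proto}
    {c : Proto × List Proto} (hf : f ∈ (gadgetNet E' n S' D').F (.gadget U 3))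
    (h : AdaptStep f (x, σ) c) :
    ∃ τ, σ = .a :: τ ∧ f = .decap .a .a ∧ c = (.a, τ) := by
  cases h <;> simp_all [gadgetNet, GF]

lemma cross_X {f : AdaptFn Proto} {x : Proto} {σ : List Proto}
    {c : Proto × List Proto} (hf : f ∈ (gadgetNet E' n S' D').F .X)
    (h : AdaptStep f (x, σ) c) :
    ∃ τ, σ = .a :: τ ∧ f = .decap .a .b ∧ c = (.a, τ) := by
  cases h <;> simp_all [gadgetNet, GF]

lemma cross_tail {i : ℕ} {f : AdaptFn Proto} {x : Proto} {σ : List Proto}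
    {c : Proto × List Proto} (hf : f ∈ (gadgetNet E' n S' D').F (.tail i))
    (h : AdaptStep f (x, σ) c) :
    x = .a ∧ ((i ≤ n ∧ f = .encap .a .a ∧ c = (.a, .a :: σ)) ∨
      (i = n + 1 ∧ f = .encap .a .b ∧ c = (.b, .a :: σ))) := by
  simp only [gadgetNet, GF] at hf
  split_ifs at hf with h1 h2
  · cases h <;> simp_all
  · cases h <;> simp_all
  · exact absurd hf (Set.notMem_empty f)

lemma ArcTrail.mem_arcs_one_two {U : V'} {v : GNode V'} {c : Proto × List Proto}
    {steps : List (GNode V' × AdaptFn Proto)}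
    (h : ArcTrail (gadgetNet E' n S' D') .dst v c steps)
    (hv : v ≠ .gadget U 1 ∧ v ≠ .gadget U 2 ∧ v ≠ .gadget U 3)
    (hU : (.gadget U 2, .gadget U 3) ∈ arcs .dst v steps) :
    (.gadget U 0, .gadget U 1) ∈ arcs .dst v steps := by
  refine h.mem_arcs_of_cut
    (fun w => w ≠ .gadget U 1 ∧ w ≠ .gadget U 2 ∧ w ≠ .gadget U 3) ?_ hv hU (by simp)
  rintro (⟨W, j⟩ | i | _ | _) (⟨Z, k⟩ | i' | _ | _) hE hx hy
  · fin_cases j <;> fin_cases k <;> simp_all [gadgetNet, GEdge]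
  all_goals simp_all [gadgetNet, GEdge]

lemma ArcTrail.mem_arcs_two_three {U : V'} {v : GNode V'} {c : Proto × List Proto}
    {steps : List (GNode V' × AdaptFn Proto)}
    (h : ArcTrail (gadgetNet E' n S' D') .dst v c steps)
    (hv : v ≠ .gadget U 2 ∧ v ≠ .gadget U 3)
    (hU : (.gadget U 2, .gadget U 3) ∈ arcs .dst v steps) :
    (.gadget U 1, .gadget U 2) ∈ arcs .dst v steps := by
  refine h.mem_arcs_of_cut (fun w => w ≠ .gadget U 2 ∧ w ≠ .gadget U 3) ?_ hv hU (by simp)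
  rintro (⟨W, j⟩ | i | _ | _) (⟨Z, k⟩ | i' | _ | _) hE hx hy
  · fin_cases j <;> fin_cases k <;> simp_all [gadgetNet, GEdge]
  all_goals simp_all [gadgetNet, GEdge]

lemma ArcTrail.mem_arcs_X {v : GNode V'} {c : Proto × List Proto}
    {steps : List (GNode V' × AdaptFn Proto)}
    (h : ArcTrail (gadgetNet E' n S' D') .dst v c steps) (hv : v ≠ .X ∧ v ≠ .dst) :
    (.gadget D' 0, .X) ∈ arcs .dst v steps := by
  obtain ⟨x, hx⟩ := h.exists_mem_arcs
  refine h.mem_arcs_of_cut (fun w => w ≠ .X ∧ w ≠ .dst) ?_ hv hx (by simp)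
  rintro (⟨W, j⟩ | i | _ | _) (⟨Z, k⟩ | i' | _ | _) hE hx hy <;> simp_all [gadgetNet, GEdge]

lemma ArcTrail.mem_arcs_tail {i j : ℕ} (hji : j ≤ i) (hi : i ≤ n) {c : Proto × List Proto}
    {steps : List (GNode V' × AdaptFn Proto)}
    (h : ArcTrail (gadgetNet E' n S' D') .dst (.tail j) c steps) :
    (.tail i, .tail (i + 1)) ∈ arcs .dst (.tail j) steps := by
  obtain ⟨x, hx⟩ := h.exists_mem_arcs
  refine h.mem_arcs_of_cut (fun w => ∃ k ≤ i, w = .tail k) ?_ ⟨j, hji, rfl⟩ hx (by simp)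
  rintro x y hE ⟨k, hk, rfl⟩ hy
  rcases edge_tail (hk.trans hi) hE with rfl | ⟨m, rfl, rfl⟩
  · simp only [GNode.tail.injEq, not_exists, not_and] at hy ⊢
    have := hy (k + 1)
    omega
  · exact absurd ⟨m, by omega, rfl⟩ hy

/-- The trail reaches the fourth node of every gadget whose first arc it traverses. -/
def EntersFully (v : GNode V') (steps : List (GNode V' × AdaptFn Proto)) : Prop :=
  ∀ U : V', (.gadget U 0, .gadget U 1) ∈ arcs .dst v steps →
    (.gadget U 2, .gadget U 3) ∈ arcs .dst v steps

lemma EntersFully.of_cons {V : V'} {v : GNode V'} {f : AdaptFn Proto}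
    {rest : List (GNode V' × AdaptFn Proto)}
    (h : EntersFully v ((.gadget V 0, f) :: rest)) : EntersFully (.gadget V 0) rest := by
  intro U hU
  simpa using h U (by simp [hU])

lemma ArcTrail.not_stack_b_b {U : V'} {τ : List Proto}
    {steps : List (GNode V' × AdaptFn Proto)}
    (h : ArcTrail (gadgetNet E' n S' D') .dst (.gadget U 0) (.b, .b :: .b :: τ) steps)
    (hH : EntersFully (.gadget U 0) steps) : False := by
  induction steps generalizing U τ with
  | nil => cases h
  | cons s rest ih =>
    cases h with
    | cons hE hf hs hn hr =>
    rcases edge_gadget_zero hE with rfl | ⟨V, rfl, -⟩ | rfl | ⟨rfl, -⟩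
    · obtain ⟨τ', hτ, rfl, rfl⟩ := cross_gadget_one_b hf hs
      cases hτ
      have h34 := hH U (by simp)
      cases hr with
      | cons hE hf hs _ hr =>
      rcases edge_gadget_one hE with rfl | rfl
      · refine hn (List.mem_cons_of_mem _ (hr.mem_arcs_one_two (by simp) ?_))
        simpa using h34
      · obtain ⟨τ', hτ, -⟩ := cross_gadget_two_b hf hs
        cases hτ
    · obtain ⟨rfl, rfl⟩ := cross_gadget_zero_b hf hs
      exact ih hr hH.of_cons
    · cases (cross_tail hf hs).1
    · obtain ⟨τ', hτ, -⟩ := cross_X hf hs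
      cases hτ

/-- After crossing `U₁` by `(b→bb)`, the trail performs the rest of the gadget sequence of `U`. -/
lemma ArcTrail.exists_gadgetSeq {U : V'} {τ : List Proto}
    {steps : List (GNode V' × AdaptFn Proto)}
    (h : ArcTrail (gadgetNet E' n S' D') .dst (.gadget U 0) (.b, .b :: τ) steps)
    (hH : EntersFully (.gadget U 0) steps) :
    ∃ τ' rest, steps = (gadgetSeq U).tail ++ rest ∧
      (.gadget U 0, .gadget U 1) ∉ arcs .dst (.gadget U 0) rest ∧
      EntersFully (.gadget U 0) rest ∧
      ArcTrail (gadgetNet E' n S' D') .dst (.gadget U 0) (.b, .a :: τ') rest := by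
  cases h with
  | cons hE hf hs hn hr =>
  rcases edge_gadget_zero hE with rfl | ⟨V, rfl, -⟩ | rfl | ⟨rfl, -⟩
  rotate_left
  · obtain ⟨rfl, rfl⟩ := cross_gadget_zero_b hf hs
    exact (hr.not_stack_b_b hH.of_cons).elim
  · cases (cross_tail hf hs).1
  · obtain ⟨τ', hτ, -⟩ := cross_X hf hs
    cases hτ
  obtain ⟨τ', hτ, rfl, rfl⟩ := cross_gadget_one_b hf hs
  cases hτ
  have h34 := hH U (by simp)
  cases hr with
  | nil _ hE => simp [gadgetNet, GEdge] at hE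
  | cons hE hf hs hn2 hr =>
  rcases edge_gadget_one hE with rfl | rfl
  · refine (hn (List.mem_cons_of_mem _ (hr.mem_arcs_one_two (by simp) ?_))).elim
    simpa using h34
  obtain ⟨τ', rfl, rfl, rfl⟩ := cross_gadget_two_b hf hs
  cases hr with
  | nil _ hE => simp [gadgetNet, GEdge] at hE
  | cons hE hf hs hn3 hr =>
  rcases edge_gadget_two hE with rfl | rfl
  · refine (hn2 (List.mem_cons_of_mem _ (hr.mem_arcs_two_three (by simp) ?_))).elim
    simpa using h34
  obtain ⟨τ', rfl, rfl, rfl⟩ := cross_gadget_three hf hs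
  cases hr with
  | nil _ hE => simp [gadgetNet, GEdge] at hE
  | cons hE hf hs hn4 hr =>
  obtain rfl := edge_gadget_three hE
  obtain ⟨rfl, rfl⟩ := cross_gadget_two_a hf hs
  cases hr with
  | nil _ hE => simp [gadgetNet, GEdge] at hE
  | cons hE hf hs hn5 hr =>
  rcases edge_gadget_two hE with rfl | rfl
  swap
  · simp at hn3
  obtain ⟨rfl, rfl⟩ := cross_gadget_one_a hf hs
  cases hr with
  | nil _ hE => simp [gadgetNet, GEdge] at hE
  | cons hE hf hs hn6 hr =>
  rcases edge_gadget_one hE with rfl | rfl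
  swap
  · simp at hn2
  obtain ⟨rfl, rfl⟩ := cross_gadget_zero_a hf hs
  refine ⟨_, _, rfl, fun hU => hn (by simp [hU]), fun V hV => ?_, hr⟩
  have hne : V ≠ U := by rintro rfl; exact hn (by simp [hV])
  simpa [hne] using hH V (by simp [hV])

lemma mem_arcs_flatMap_gadgetSeq {u : V'} {l : List V'} (hu : u ∈ l) (v : GNode V')
    (steps : List (GNode V' × AdaptFn Proto)) :
    (.gadget u 0, .gadget u 1) ∈ arcs .dst v (l.flatMap gadgetSeq ++ steps) := by
  induction l generalizing v with
  | nil => simp at hu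
  | cons w l ih =>
    rcases List.mem_cons.1 hu with rfl | hu
    · simp [gadgetSeq]
    · simp [gadgetSeq, ih hu]

lemma mem_of_mem_arcs_flatMap_gadgetSeq {u : V'} {l : List V'} {v : GNode V'}
    (hv : v ≠ .gadget u 2)
    (h : (.gadget u 2, .gadget u 3) ∈
      arcs .dst v (l.flatMap gadgetSeq ++ [(.X, .decap .a .b)])) : u ∈ l := by
  induction l generalizing v with
  | nil => simp at h
  | cons w l ih =>
    by_cases huw : u = w
    · simp [huw]
    · refine List.mem_cons_of_mem _ (ih (v := .gadget w 0) (by simp) ?_)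
      simpa [gadgetSeq, huw] using h

/-- Between two gadgets the trail consists of whole gadget sequences followed by `X`. -/
lemma ArcTrail.exists_flatMap_gadgetSeq {W : V'} {τ : List Proto}
    {steps : List (GNode V' × AdaptFn Proto)}
    (h : ArcTrail (gadgetNet E' n S' D') .dst (.gadget W 0) (.b, .a :: τ) steps)
    (hH : EntersFully (.gadget W 0) steps) :
    ∃ l : List V', steps = l.flatMap gadgetSeq ++ [(.X, .decap .a .b)] ∧
      (W :: l).IsChain E' ∧ (W :: l).getLast? = some D' ∧ l.Nodup := by
  induction hk : steps.length using Nat.strong_induction_on generalizing W τ steps with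
  | _ k ih =>
  subst hk
  cases h with
  | cons hE hf hs hn hr =>
  rcases edge_gadget_zero hE with rfl | ⟨V, rfl, hWV⟩ | rfl | ⟨rfl, rfl⟩
  · obtain ⟨τ', hτ, -⟩ := cross_gadget_one_b hf hs
    cases hτ
  · obtain ⟨rfl, rfl⟩ := cross_gadget_zero_b hf hs
    obtain ⟨τ', rest, rfl, hV, hH', hr'⟩ := hr.exists_gadgetSeq hH.of_cons
    obtain ⟨l, rfl, hc, hl, hnd⟩ := ih _ (by simp) hr' hH' rfl
    refine ⟨V :: l, rfl, List.isChain_cons_cons.2 ⟨hWV, hc⟩, by simpa using hl,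
      List.nodup_cons.2 ⟨fun hVl => hV (mem_arcs_flatMap_gadgetSeq hVl _ _), hnd⟩⟩
  · cases (cross_tail hf hs).1
  · obtain ⟨τ', -, rfl, rfl⟩ := cross_X hf hs
    cases hr with
    | nil => exact ⟨[], rfl, by simp, by simp, by simp⟩
    | cons hE hf hs hn' hr =>
    rcases edge_X hE with rfl | rfl
    · exact (hn (List.mem_cons_of_mem _ (hr.mem_arcs_X (by simp)))).elim
    · simp [gadgetNet, GF] at hf

/-- Each protocol `a` in the configuration but one is removed in the fourth node of a
different gadget. -/
lemma ArcTrail.count_le [Fintype V'] {v : GNode V'} {c : Proto × List Proto}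
    {steps : List (GNode V' × AdaptFn Proto)}
    (h : ArcTrail (gadgetNet E' n S' D') .dst v c steps) :
    (c.1 :: c.2).count .a ≤
      1 + {U : V' | (.gadget U 2, .gadget U 3) ∈ arcs .dst v steps}.ncard := by
  induction h with
  | nil x => cases x <;> simp
  | @cons v U f c c' rest hE hf hs hn hr ih =>
    have hsub : {W : V' | (.gadget W 2, .gadget W 3) ∈ arcs .dst U rest} ⊆
        {W : V' | (.gadget W 2, .gadget W 3) ∈ arcs .dst v ((U, f) :: rest)} :=
      fun W hW => List.mem_cons_of_mem _ hW
    by_cases hU : ∃ W, U = .gadget W 3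
    · obtain ⟨W, rfl⟩ := hU
      obtain rfl := edge_to_gadget_three hE
      obtain ⟨x, σ⟩ := c
      obtain ⟨τ, rfl, rfl, rfl⟩ := cross_gadget_three hf hs
      have hlt := Set.ncard_lt_ncard (Set.ssubset_iff_of_subset hsub |>.2
        ⟨W, List.mem_cons_self, hn⟩) (Set.toFinite _)
      cases hs
      simp only [List.count_cons_self] at ih ⊢
      omega
    · have hle := Set.ncard_le_ncard hsub (Set.toFinite _)
      suffices (c.1 :: c.2).count .a ≤ (c'.1 :: c'.2).count .a by omega
      rcases U with ⟨W, j⟩ | i | _ | _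
      · fin_cases j <;> cases hs <;> simp [gadgetNet, GF] at hf <;>
          (try rcases hf with ⟨rfl, rfl⟩ | ⟨rfl, rfl⟩) <;> simp_all
      · simp only [gadgetNet, GF] at hf
        split_ifs at hf <;> cases hs <;> simp_all
      · cases hs <;> simp_all [gadgetNet, GF]
      · cases hs <;> simp_all [gadgetNet, GF]

lemma ArcTrail.exists_tail {m i : ℕ} (hm : i + m = n) {σ : List Proto}
    (hσ : σ = List.replicate i .a) {steps : List (GNode V' × AdaptFn Proto)}
    (h : ArcTrail (gadgetNet E' n S' D') .dst (.tail i) (.a, σ) steps)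
    (hused : ∀ j < i, (.tail j, .tail (j + 1)) ∉ arcs .dst (.tail i) steps) :
    ∃ rest, steps = (List.range m).map (fun k => (.tail (i + k + 1), .encap .a .a)) ++
        (.tail (n + 1), .encap .a .b) :: rest ∧
      ArcTrail (gadgetNet E' n S' D') .dst (.tail (n + 1))
        (.b, List.replicate (n + 1) .a) rest := by
  induction m generalizing i σ steps with
  | zero =>
    cases h with
    | nil _ hE => simp [gadgetNet, GEdge] at hE
    | cons hE hf hs hn hr =>
    rcases edge_tail (by omega) hE with rfl | ⟨j, rfl, rfl⟩
    swap
    · exact (hused j j.lt_succ_self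
        (List.mem_cons_of_mem _ (hr.mem_arcs_tail le_rfl (by omega)))).elim
    obtain ⟨-, ⟨hi, -⟩ | ⟨-, rfl, rfl⟩⟩ := cross_tail hf hs
    · omega
    · obtain rfl : i = n := hm
      exact ⟨_, rfl, by simpa [hσ, List.replicate_succ] using hr⟩
  | succ m ih =>
    cases h with
    | nil _ hE => simp [gadgetNet, GEdge] at hE
    | cons hE hf hs hn hr =>
    rcases edge_tail (by omega) hE with rfl | ⟨j, rfl, rfl⟩
    swap
    · exact (hused j j.lt_succ_self
        (List.mem_cons_of_mem _ (hr.mem_arcs_tail le_rfl (by omega)))).elim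
    obtain ⟨-, ⟨-, rfl, rfl⟩ | ⟨hi, -⟩⟩ := cross_tail hf hs
    swap
    · omega
    obtain ⟨rest, rfl, hr'⟩ := ih (by omega) (by simp [hσ, List.replicate_succ]) hr (by
      intro j hj hmem
      rcases Nat.lt_succ_iff_lt_or_eq.1 hj with hj | rfl
      · exact hused j hj (List.mem_cons_of_mem _ hmem)
      · exact hn hmem)
    refine ⟨rest, ?_, hr'⟩
    simp [List.range_succ_eq_map, Function.comp_def, Nat.add_right_comm, Nat.add_assoc]
    omega

end Gadget

/-- If the gadget network built from the symmetric digraph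
`(V', E')` contains a feasible path from `S` to `D` (source protocol `a`)
traversing each arc at most once, then this path consists of the tail, exactly one
occurrence of the sequence `U₁ (b→bb) U₂ dec(b→bb) U₃ dec(a→ab) U₄ dec(a→aa)
U₃ (a→a) U₂ (a→a) U₁ (a→ab)` for every `U' ∈ V'`, and the final crossing of `X`;
replacing each such occurrence by the corresponding node `U'` yields a vertex
sequence `l` which is a directed Hamiltonian path from `S'` to `D'` in `(V', E')`. -/
theorem feasible_arc_once_gives_ham {V' : Type*} [Fintype V'] [DecidableEq V']
    (E' : V' → V' → Prop) (hsym : ∀ u v : V', E' u v ↔ E' v u) (S' D' : V')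
    (steps : List (GNode V' × AdaptFn Proto))
    (hfeas : IsFeasiblePath (gadgetNet E' (Fintype.card V') S' D') (.tail 0) .dst .a steps)
    (honce : ArcsOnce (nodeSeq (GNode.tail 0) GNode.dst steps)) :
    ∃ l : List V', IsDirHamPath E' S' D' l ∧ steps = hamSteps (Fintype.card V') l := by
  obtain ⟨hchain, x, hrun⟩ := hfeas
  obtain ⟨rest, rfl, hr⟩ :=
    (hrun.arcTrail hchain honce).exists_tail (Nat.zero_add _) rfl (by simp)
  cases hr with
  | cons hE hf hs hn hr =>
  rcases edge_tail_last hE with rfl | ⟨i, rfl⟩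
  swap
  · cases (cross_tail hf hs).1
  obtain ⟨rfl, rfl⟩ := cross_gadget_zero_b hf hs
  rename_i rest
  have huniv : ∀ U : V',
      (GNode.gadget U 2, GNode.gadget U 3) ∈ arcs .dst (.gadget S' 0) rest := by
    have hcount := hr.count_le
    simp only [List.count_cons, List.count_replicate_self, beq_iff_eq, reduceCtorEq,
      if_false] at hcount
    set T := {U : V' | (GNode.gadget U 2, GNode.gadget U 3) ∈ arcs .dst (.gadget S' 0) rest}
    suffices T = Set.univ from Set.eq_univ_iff_forall.1 this
    refine Set.eq_of_subset_of_ncard_le (Set.subset_univ _) ?_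
    rw [Set.ncard_univ, Nat.card_eq_fintype_card]
    omega
  obtain ⟨τ, rest, rfl, hS, hH, hr'⟩ := hr.exists_gadgetSeq fun U _ => huniv U
  obtain ⟨l, rfl, hc, hl, hnd⟩ := hr'.exists_flatMap_gadgetSeq hH
  refine ⟨S' :: l, ⟨rfl, hl, hc, List.nodup_cons.2 ⟨fun hmem => hS ?_, hnd⟩, fun u => ?_⟩, ?_⟩
  · exact mem_arcs_flatMap_gadgetSeq hmem _ _
  · refine mem_of_mem_arcs_flatMap_gadgetSeq (v := .X) (by simp) ?_
    simpa [gadgetSeq] using huniv u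
  · simp [hamSteps, tailSteps, gadgetSeq]
end

section
/- Let N be the gadget multi-layer network over protocols A={a,b} constructed from a finite symmetric directed graph H=(V',E') with distinguished nodes S', D'. No feasible path from S to D in N contains three consecutive nodes U_1, V_1, W_1 that are all of type 1 (i.e., nodes of the form Z_1 for some Z' ∈ V'): crossing such a sequence would push three consecutive occurrences of protocol b onto the stack, and in N there is no sequence of nodes and adaptation functions able to decapsulate protocol b three consecutive times, so any path containing such a sequence fails to end at D with an empty stack. -/
/-- Configurations from which the gadget network cannot recover: having just crossed `v`, the
current protocol is `b` and two copies of `b` (at `U₁`) or one (at `U₂`) lie on top of the stack. -/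
inductive Trapped {V' : Type*} : GNode V' → Proto × List Proto → Prop
  | one (U : V') (σ : List Proto) : Trapped (.gadget U 0) (.b, .b :: .b :: σ)
  | two (U : V') (σ : List Proto) : Trapped (.gadget U 1) (.b, .b :: σ)

/-- Crossing a node of type 1 pushes the current protocol and leaves `b` as current protocol. -/
theorem adaptStep_type_one {V' : Type*} {E' : V' → V' → Prop} {n : ℕ} {S' D' U : V'}
    {f : AdaptFn Proto} {c c' : Proto × List Proto}
    (hf : f ∈ (gadgetNet E' n S' D').F (.gadget U 0)) (hs : AdaptStep f c c') :
    c' = (.b, c.1 :: c.2) := by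
  rcases hf with rfl | rfl <;> cases hs <;> rfl

theorem Trapped.step {V' : Type*} {E' : V' → V' → Prop} {n : ℕ} {S' D' : V'} {v w : GNode V'}
    {f : AdaptFn Proto} {c c' : Proto × List Proto} (ht : Trapped v c)
    (he : (gadgetNet E' n S' D').Edge v w) (hf : f ∈ (gadgetNet E' n S' D').F w)
    (hs : AdaptStep f c c') : Trapped w c' := by
  cases w with
  | gadget W j =>
    fin_cases j
    · obtain rfl := adaptStep_type_one hf hs
      cases ht <;> exact .one _ _
    · cases ht <;> rcases hf with rfl | rfl <;> cases hs
      · exact .two _ _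
      · simp [gadgetNet, GEdge] at he
    · cases ht <;> rcases hf with rfl | rfl <;> cases hs
    · cases ht <;> cases hf <;> cases hs
  | tail i =>
    cases ht <;> obtain ⟨rfl, -⟩ := he <;>
      · simp [gadgetNet, GF] at hf
        subst hf
        cases hs
  | X => cases ht <;> cases hf <;> cases hs
  | dst => cases hf

theorem Trapped.not_reach_dst {V' : Type*} {E' : V' → V' → Prop} {n : ℕ} {S' D' : V'}
    {steps : List (GNode V' × AdaptFn Proto)} {v : GNode V'} {c c' : Proto × List Proto}
    (ht : Trapped v c) (hr : Run (gadgetNet E' n S' D') c steps c') :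
    ¬ (v :: (steps.map Prod.fst ++ [GNode.dst])).IsChain (gadgetNet E' n S' D').Edge := by
  induction hr generalizing v with
  | nil c =>
    intro hc
    have he := (List.isChain_cons_cons.1 hc).1
    cases ht <;> exact he
  | cons hf hs _ ih =>
    intro hc
    obtain ⟨he, hc⟩ := List.isChain_cons_cons.1 hc
    exact ih (ht.step he hf hs) hc

/-- A run that ends at `D` never crosses three consecutive nodes of type 1. -/
theorem Run.not_type_one_infix {V' : Type*} {E' : V' → V' → Prop} {n : ℕ} {S' D' : V'}
    {steps : List (GNode V' × AdaptFn Proto)} {c c' : Proto × List Proto}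
    (hr : Run (gadgetNet E' n S' D') c steps c')
    (hc : (steps.map Prod.fst ++ [GNode.dst]).IsChain (gadgetNet E' n S' D').Edge) (U W Z : V') :
    ¬ [GNode.gadget U 0, GNode.gadget W 0, GNode.gadget Z 0] <:+:
        steps.map Prod.fst ++ [GNode.dst] := by
  induction hr with
  | nil c => exact fun h => by simpa using h.length_le
  | @cons V f c₀ c₁ c₂ rest hf hs hr ih =>
    intro h
    rcases List.infix_cons_iff.1 h with hp | hi
    · simp only [List.append_eq, List.cons_prefix_cons] at hp
      obtain ⟨rfl, hp⟩ := hp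
      obtain rfl := adaptStep_type_one hf hs
      cases hr with
      | nil => simp at hp
      | cons hf₁ hs₁ hr =>
        simp only [List.map_cons, List.cons_append, List.cons_prefix_cons] at hp
        obtain ⟨rfl, hp⟩ := hp
        obtain rfl := adaptStep_type_one hf₁ hs₁
        cases hr with
        | nil => simp at hp
        | cons hf₂ hs₂ hr =>
          simp only [List.map_cons, List.cons_append, List.cons_prefix_cons] at hp
          obtain ⟨rfl, -⟩ := hp
          obtain rfl := adaptStep_type_one hf₂ hs₂
          exact (Trapped.one Z _).not_reach_dst hr hc.tail.tail
    · exact ih hc.tail hi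

/-- In the gadget network built from a finite symmetric digraph
`(V', E')`, no feasible path from `S` to `D` (source protocol `a`) contains three
consecutive nodes of type 1, i.e. the node sequence of a feasible path has no
infix of the form `U₁ V₁ W₁`. -/
theorem no_three_consecutive_type_one {V' : Type*} [Fintype V'] [DecidableEq V']
    (E' : V' → V' → Prop) (hsym : ∀ u v : V', E' u v ↔ E' v u) (S' D' : V')
    (steps : List (GNode V' × AdaptFn Proto))
    (hfeas : IsFeasiblePath (gadgetNet E' (Fintype.card V') S' D') (.tail 0) .dst .a steps) :
    ¬ ∃ U W Z : V',
      [GNode.gadget U 0, GNode.gadget W 0, GNode.gadget Z 0] <:+: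
        nodeSeq (GNode.tail 0) GNode.dst steps := by
  rintro ⟨U, W, Z, h⟩
  obtain ⟨hc, x, hr⟩ := hfeas
  rcases List.infix_cons_iff.1 h with h | h
  · simp at h
  · exact hr.not_type_one_infix hc.tail U W Z h
end
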